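/- Let A ⊂ [0,1) be s-simple (A ∩ s(A) has measure zero, where s(x) = (x+1/2) mod 1). Then there exists a measurable set D ⊂ [0,1) disjoint from A such that M := A ∪ D satisfies: M and s(M) partition [0,1) up to measure zero. -/

import Mathlib

open MeasureTheory

theorem fract_add_half_of_lt_half {x : ℝ} (h0 : 0 ≤ x) (h1 : x < 1 / 2) :
    Int.fract (x + 1 / 2) = x + 1 / 2 :=
  Int.fract_eq_self.2 ⟨by linarith, by linarith⟩

theorem fract_add_half_of_half_le {x : ℝ} (h0 : 1 / 2 ≤ x) (h1 : x < 1) :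
    Int.fract (x + 1 / 2) = x - 1 / 2 :=
  Int.fract_eq_iff.2 ⟨by linarith, by linarith, 1, by push_cast; ring⟩

theorem fract_add_half_fract_add_half {x : ℝ} (hx : x ∈ Set.Ico (0 : ℝ) 1) :
    Int.fract (Int.fract (x + 1 / 2) + 1 / 2) = x := by
  obtain ⟨h0, h1⟩ := hx
  rcases lt_or_ge x (1 / 2) with h | h
  · rw [fract_add_half_of_lt_half h0 h,
      fract_add_half_of_half_le (by linarith) (by linarith)]
    ring
  · rw [fract_add_half_of_half_le h h1,
      fract_add_half_of_lt_half (by linarith) (by linarith)]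
    ring

/-- Any `s`-simple measurable set `A ⊆ [0,1)` (where `s(x) = (x + 1/2) mod 1`) can be
completed to an `s`-tile: there is a measurable `D ⊆ [0,1)` disjoint from `A` such that
`M = A ∪ D` and `s(M)` partition `[0,1)` up to measure zero. -/
theorem s_simple_completion (A : Set ℝ) (hA : A ⊆ Set.Ico (0 : ℝ) 1)
    (hAm : MeasurableSet A)
    (hsimple : volume (A ∩ (fun y => Int.fract (y + 1 / 2)) '' A) = 0) :
    ∃ D : Set ℝ, MeasurableSet D ∧ D ⊆ Set.Ico (0 : ℝ) 1 ∧ Disjoint A D ∧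
      volume ((A ∪ D) ∩ (fun y => Int.fract (y + 1 / 2)) '' (A ∪ D)) = 0 ∧
      volume (Set.Ico (0 : ℝ) 1
        \ ((A ∪ D) ∪ (fun y => Int.fract (y + 1 / 2)) '' (A ∪ D))) = 0 := by
  refine ⟨Set.Ico 0 (1 / 2) \ (A ∪ (fun y => y + 1 / 2) ⁻¹' A), ?_, ?_, ?_, ?_, ?_⟩
  · exact measurableSet_Ico.diff (hAm.union (hAm.preimage (by fun_prop)))
  · rintro x ⟨⟨h0, h1⟩, -⟩
    exact ⟨h0, by linarith⟩
  · exact Set.disjoint_left.2 fun x hx hD => hD.2 (Or.inl hx)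
  · refine measure_mono_null ?_ hsimple
    rintro _ ⟨hx, y, hy, rfl⟩
    dsimp only at hx ⊢
    rcases hy with hy | ⟨⟨hy0, hy1⟩, hyA⟩
    · rcases hx with hx | ⟨⟨hx0, hx1⟩, hxA⟩
      · exact ⟨hx, y, hy, rfl⟩
      · refine absurd (Or.inr ?_) hxA
        rw [Set.mem_preimage, ← fract_add_half_of_lt_half hx0 hx1,
          fract_add_half_fract_add_half (hA hy)]
        exact hy
    · rw [fract_add_half_of_lt_half hy0 hy1] at hx
      rcases hx with hx | ⟨⟨-, hx1⟩, -⟩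
      · exact absurd (Or.inr hx) hyA
      · linarith
  · refine measure_mono_null (t := ∅) ?_ measure_empty
    rintro x ⟨hx, hxM⟩
    refine hxM ?_
    by_cases hxA : x ∈ A
    · exact Or.inl (Or.inl hxA)
    by_cases hsA : Int.fract (x + 1 / 2) ∈ A
    · exact Or.inr ⟨_, Or.inl hsA, fract_add_half_fract_add_half hx⟩
    rcases lt_or_ge x (1 / 2) with h | h
    · rw [fract_add_half_of_lt_half hx.1 h] at hsA
      exact Or.inl (Or.inr ⟨⟨hx.1, h⟩, not_or.2 ⟨hxA, hsA⟩⟩)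
    · refine Or.inr ⟨_, Or.inr ?_, fract_add_half_fract_add_half hx⟩
      rw [fract_add_half_of_half_le h hx.2] at hsA ⊢
      refine ⟨⟨by linarith, by linarith [hx.2]⟩, not_or.2 ⟨hsA, ?_⟩⟩
      simpa using hxA
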